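/- Suppose a convex cone K possesses a strictly separating family K̃ of characters taking values in [0,1]. Then each idempotent SαS random element ξ with finite exponent α≠0 is necessarily a deterministic idempotent element of K: there exists z∈K with z+z=z such that ξ=z almost surely. -/

import Mathlib

open Filter Topology MeasureTheory

/-- A continuous measure-preserving self-map of a Polish probability space is a.e. surjective. -/
lemma ae_mem_range_of_measurePreserving {X : Type*} [TopologicalSpace X] [PolishSpace X]
    [MeasurableSpace X] [BorelSpace X] (π : Measure X) [IsProbabilityMeasure π]
    (T : X → X) (hT : Continuous T) (hpres : π.map T = π) : ∀ᵐ p ∂π, p ∈ Set.range T := by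
  rw [ae_iff]
  refine le_antisymm (le_of_forall_gt_imp_ge_of_dense fun ε hε => ?_) (zero_le)
  obtain ⟨C, hC, hCε⟩ := (isTightMeasureSet_iff_exists_isCompact_measure_compl_le.1
    (isTightMeasureSet_singleton (μ := π))) ε hε
  have hC' := hCε π rfl
  have hTC : IsCompact (T '' C) := hC.image hT
  calc π {a | a ∉ Set.range T} ≤ π (T '' C)ᶜ := by
        apply measure_mono
        rintro a ha ⟨c, _, rfl⟩
        exact ha ⟨c, rfl⟩
    _ = π.map T (T '' C)ᶜ := by rw [hpres]
    _ = π (T ⁻¹' (T '' C)ᶜ) := Measure.map_apply hT.measurable hTC.measurableSet.compl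
    _ ≤ π Cᶜ := by
        apply measure_mono
        intro a ha hac
        exact ha ⟨a, hac, rfl⟩
    _ ≤ ε := hC'

/-- Choquet-Deny type argument: translations of an idempotent measure are a.e. trivial. -/
lemma translate_ae_eq {K : Type*} [MetricSpace K] [PolishSpace K] [AddCommMonoid K]
    [MeasurableSpace K] [BorelSpace K]
    (hadd : Continuous fun p : K × K => p.1 + p.2)
    (ν : Measure K) [IsProbabilityMeasure ν]
    (hidem : Measure.map (fun p : K × K => p.1 + p.2) (ν.prod ν) = ν)
    (B : Set K) (hB : MeasurableSet B) :
    ∀ᵐ x ∂ν, ν {y | x + y ∈ B} = ν B := by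
  have hm : Measurable fun p : K × K => p.1 + p.2 := hadd.measurable
  have hmx : ∀ x : K, Measurable fun y : K => x + y := fun x =>
    hm.comp (measurable_const.prodMk measurable_id)
  have hG : Measurable fun x : K => ν {y | x + y ∈ B} := measurable_measure_prodMk_left (hm hB)
  set F : K → ℝ := fun x => (ν {y | x + y ∈ B}).toReal with hFdef
  have hF : Measurable F := hG.ennreal_toReal
  have hFub : ∀ B : Set K, MeasurableSet B → ∫⁻ x, ν {y | x + y ∈ B} ∂ν = ν B := by
    intro B hB
    conv_rhs => rw [← hidem, Measure.map_apply hm hB, Measure.prod_apply (hm hB)]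
    rfl
  have hF0 : ∀ x, 0 ≤ F x := fun x => ENNReal.toReal_nonneg
  have hF1 : ∀ x, F x ≤ 1 := fun x => ENNReal.toReal_le_of_le_ofReal (by norm_num) (by simpa using prob_le_one)
  have hFint : ∫ x, F x ∂ν = (ν B).toReal := by
    rw [integral_toReal hG.aemeasurable (ae_of_all _ fun x => measure_lt_top _ _), hFub B hB]
  have hharm : ∀ x, ∫ y, F (x + y) ∂ν = F x := by
    intro x
    have h := hFub _ (hmx x hB)
    have h2 := integral_toReal (μ := ν) (f := fun y => ν {w | (x + y) + w ∈ B})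
      (hG.comp (hmx x)).aemeasurable (ae_of_all _ fun x => measure_lt_top _ _)
    simp only [hFdef]
    rw [h2]
    congr 1
    simp only [Set.mem_preimage, ← add_assoc] at h
    exact h
  have bdd : ∀ {Y : Type _} [MeasurableSpace Y] (ρ : Measure Y) [IsProbabilityMeasure ρ]
      (f : Y → ℝ), Measurable f → (∀ y, 0 ≤ f y) → (∀ y, f y ≤ 1) → Integrable f ρ := by
    intro Y _ ρ _ f hf h0 h1
    refine Integrable.of_bound hf.aestronglyMeasurable 1 (ae_of_all _ fun y => ?_)
    rw [Real.norm_eq_abs, abs_of_nonneg (h0 y)]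
    exact h1 y
  have hFa : Measurable fun p : K × K => F (p.1 + p.2) := hF.comp hm
  have hFf : Measurable fun p : K × K => F p.1 := hF.comp measurable_fst
  have i1 : Integrable (fun p : K × K => F (p.1 + p.2) ^ 2) (ν.prod ν) :=
    bdd _ _ (hFa.pow_const 2) (fun p => sq_nonneg _) (fun p => pow_le_one₀ (hF0 _) (hF1 _))
  have i2 : Integrable (fun p : K × K => F p.1 * F (p.1 + p.2)) (ν.prod ν) :=
    bdd _ _ (hFf.mul hFa) (fun p => mul_nonneg (hF0 _) (hF0 _))
      (fun p => mul_le_one₀ (hF1 _) (hF0 _) (hF1 _))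
  have i3 : Integrable (fun p : K × K => F p.1 ^ 2) (ν.prod ν) :=
    bdd _ _ (hFf.pow_const 2) (fun p => sq_nonneg _) (fun p => pow_le_one₀ (hF0 _) (hF1 _))
  have e1 : ∫ p : K × K, F (p.1 + p.2) ^ 2 ∂(ν.prod ν) = ∫ x, F x ^ 2 ∂ν := by
    conv_rhs => rw [← hidem]
    rw [integral_map hm.aemeasurable (hF.pow_const 2).aestronglyMeasurable]
  have e2 : ∫ p : K × K, F p.1 * F (p.1 + p.2) ∂(ν.prod ν) = ∫ x, F x ^ 2 ∂ν := by
    rw [integral_prod _ i2]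
    refine integral_congr_ae (ae_of_all _ fun x => ?_)
    simp only
    rw [integral_const_mul, hharm, sq]
  have e3 : ∫ p : K × K, F p.1 ^ 2 ∂(ν.prod ν) = ∫ x, F x ^ 2 ∂ν := by
    rw [integral_prod _ i3]
    simp
  have hsum : ∫ p : K × K, (F (p.1 + p.2) - F p.1) ^ 2 ∂(ν.prod ν) = 0 := by
    have : (fun p : K × K => (F (p.1 + p.2) - F p.1) ^ 2) =
        fun p => (F (p.1 + p.2) ^ 2 - 2 * (F p.1 * F (p.1 + p.2))) + F p.1 ^ 2 := by
      ext p; ring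
    have i12 : Integrable (fun p : K × K => F (p.1 + p.2) ^ 2 - 2 * (F p.1 * F (p.1 + p.2)))
        (ν.prod ν) := i1.sub (i2.const_mul 2)
    rw [this, integral_add i12 i3, integral_sub i1 (i2.const_mul 2),
      integral_const_mul, e1, e2, e3]
    ring
  have iq : Integrable (fun p : K × K => (F (p.1 + p.2) - F p.1) ^ 2) (ν.prod ν) := by
    refine bdd _ _ ((hFa.sub hFf).pow_const 2) (fun p => sq_nonneg _) (fun p => ?_)
    nlinarith [hF0 (p.1 + p.2), hF1 (p.1 + p.2), hF0 p.1, hF1 p.1]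
  have h1 : ∀ᵐ p ∂(ν.prod ν), F (p.1 + p.2) = F p.1 := by
    have := (integral_eq_zero_iff_of_nonneg (fun p : K × K => sq_nonneg _) iq).1 hsum
    filter_upwards [this] with p hp
    have : (F (p.1 + p.2) - F p.1) ^ 2 = 0 := hp
    linarith [pow_eq_zero_iff (two_ne_zero) |>.1 this]
  have h2 : ∀ᵐ p ∂(ν.prod ν), F (p.2 + p.1) = F p.2 :=
    (Measure.measurePreserving_swap (μ := ν) (ν := ν)).quasiMeasurePreserving.ae h1
  have h3 : ∀ᵐ p ∂(ν.prod ν), F p.2 = F p.1 := by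
    filter_upwards [h1, h2] with p hp hp2
    rw [← hp, ← hp2, add_comm]
  filter_upwards [Measure.ae_ae_of_ae_prod h3] with x hx
  have : ∫ y, F y ∂ν = F x := by
    rw [integral_congr_ae hx]
    simp
  rw [hFint] at this
  exact ((ENNReal.toReal_eq_toReal_iff' (measure_ne_top _ _) (measure_ne_top _ _)).1 this).symm

lemma shear_preserving {K : Type*} [MetricSpace K] [PolishSpace K] [AddCommMonoid K]
    [MeasurableSpace K] [BorelSpace K]
    (hadd : Continuous fun p : K × K => p.1 + p.2)
    (ν : Measure K) [IsProbabilityMeasure ν]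
    (hidem : Measure.map (fun p : K × K => p.1 + p.2) (ν.prod ν) = ν) :
    (ν.prod ν).map (fun p : K × K => (p.1, p.1 + p.2)) = ν.prod ν := by
  have hm : Measurable fun p : K × K => p.1 + p.2 := hadd.measurable
  have hPhi : Measurable fun p : K × K => (p.1, p.1 + p.2) := measurable_fst.prodMk hm
  symm
  apply Measure.prod_eq
  intro A B hA hB
  rw [Measure.map_apply hPhi (hA.prod hB), Measure.prod_apply (hPhi (hA.prod hB))]
  have : ∀ᵐ x ∂ν, ν (Prod.mk x ⁻¹' ((fun p : K × K => (p.1, p.1 + p.2)) ⁻¹' A ×ˢ B)) =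
      A.indicator (fun _ => ν B) x := by
    filter_upwards [translate_ae_eq hadd ν hidem B hB] with x hx
    by_cases hxA : x ∈ A
    · rw [Set.indicator_of_mem hxA, ← hx]
      congr 1
      ext y
      simp [hxA]
    · rw [Set.indicator_of_notMem hxA]
      convert measure_empty (μ := ν)
      ext y
      simp [hxA]
  rw [lintegral_congr_ae this, lintegral_indicator hA]
  simp [mul_comm]


/-- Suppose a convex cone `K` (with continuous involution `inv`)
possesses a strictly separating family `Kt` of characters taking values in `[0,1]`
(realised as real-valued functions; for such characters the involution condition reads
`χ (inv x) = χ x`).  Then each idempotent strictly `α`-stable random element `ξ` with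
finite exponent `α ≠ 0` is a deterministic idempotent element of `K`: there is `z ∈ K`
with `z + z = z` and `ξ = z` almost surely.  Lean's `0 : K` is the neutral element. -/
theorem idempotent_SaS_is_deterministic
    {K : Type*} [MetricSpace K] [PolishSpace K] [AddCommMonoid K] [SMul ℝ K]
    [MeasurableSpace K] [BorelSpace K]
    (hadd_cont : Continuous fun p : K × K => p.1 + p.2)
    (hsmul_cont : ContinuousOn (fun p : ℝ × K => p.1 • p.2)
      (Set.Ioi (0 : ℝ) ×ˢ (Set.univ : Set K)))
    (hsmul_add : ∀ a : ℝ, 0 < a → ∀ x y : K, a • (x + y) = a • x + a • y)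
    (hsmul_assoc : ∀ a b : ℝ, 0 < a → 0 < b → ∀ x : K, a • (b • x) = (a * b) • x)
    (hone_smul : ∀ x : K, (1 : ℝ) • x = x)
    (hsmul_e : ∀ a : ℝ, 0 < a → a • (0 : K) = (0 : K))
    (inv : K → K)
    (hinv_cont : Continuous inv)
    (hinv_add : ∀ x y : K, inv (x + y) = inv x + inv y)
    (hinv_invol : ∀ x : K, inv (inv x) = x)
    (hinv_smul : ∀ a : ℝ, 0 < a → ∀ x : K, inv (a • x) = a • inv x)
    (Kt : Set (K → ℝ))
    (hKt_char : ∀ χ ∈ Kt, (∀ x : K, χ x ∈ Set.Icc (0 : ℝ) 1) ∧ χ 0 = 1 ∧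
      (∀ x y : K, χ (x + y) = χ x * χ y) ∧ ∀ x : K, χ (inv x) = χ x)
    (hstrict_sep : ∀ x y : K, x ≠ y → ∃ χ ∈ Kt, ∃ U ∈ 𝓝 x, ∃ V ∈ 𝓝 y,
      ∀ x' ∈ U, ∀ y' ∈ V, χ x' ≠ χ y')
    {Ω : Type*} [MeasurableSpace Ω] (μ : Measure Ω) [IsProbabilityMeasure μ]
    (ξ : Ω → K) (hξmeas : Measurable ξ)
    (α : ℝ) (hα : α ≠ 0)
    (hSaS : ∀ a b : ℝ, 0 < a → 0 < b →
      Measure.map (fun p : K × K => (a ^ (1 / α)) • p.1 + (b ^ (1 / α)) • p.2)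
          ((μ.map ξ).prod (μ.map ξ)) =
        Measure.map (fun x : K => ((a + b) ^ (1 / α)) • x) (μ.map ξ))
    (hidem : Measure.map (fun p : K × K => p.1 + p.2) ((μ.map ξ).prod (μ.map ξ))
      = μ.map ξ) :
    ∃ z : K, z + z = z ∧ ∀ᵐ ω ∂μ, ξ ω = z := by
  have : IsProbabilityMeasure (μ.map ξ) := Measure.isProbabilityMeasure_map hξmeas.aemeasurable
  set ν := μ.map ξ with hν
  have hsh := shear_preserving hadd_cont ν hidem
  have hcont : Continuous fun p : K × K => (p.1, p.1 + p.2) := continuous_fst.prodMk hadd_cont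
  have r1 := ae_mem_range_of_measurePreserving (ν.prod ν) _ hcont hsh
  have r2 : ∀ᵐ p ∂(ν.prod ν), p.swap ∈ Set.range fun p : K × K => (p.1, p.1 + p.2) :=
    (Measure.measurePreserving_swap (μ := ν) (ν := ν)).quasiMeasurePreserving.ae r1
  have hχ : ∀ᵐ p ∂(ν.prod ν), ∀ χ ∈ Kt, χ p.1 = χ p.2 := by
    filter_upwards [r1, r2] with p h1 h2 χ hχ
    obtain ⟨⟨a, b⟩, hab⟩ := h1
    obtain ⟨⟨c, d⟩, hcd⟩ := h2
    obtain ⟨x, y⟩ := p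
    simp only [Prod.mk.injEq, Prod.swap_prod_mk] at hab hcd
    obtain ⟨rfl, hab⟩ := hab
    obtain ⟨rfl, hcd⟩ := hcd
    obtain ⟨hI, -, hmul, -⟩ := hKt_char χ hχ
    have e1 := hmul a b
    have e2 := hmul c d
    rw [hab] at e1
    rw [hcd] at e2
    simp only
    apply le_antisymm
    · rw [e2]; exact mul_le_of_le_one_right (hI _).1 (hI _).2
    · rw [e1]; exact mul_le_of_le_one_right (hI _).1 (hI _).2
  have hsupp : ∀ x ∈ ν.support, ∀ y ∈ ν.support, x = y := by
    intro x hx y hy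
    by_contra hne
    obtain ⟨χ, hχK, U, hU, V, hV, hUV⟩ := hstrict_sep x y hne
    have hUp := (Measure.mem_support_iff_forall x).1 hx U hU
    have hVp := (Measure.mem_support_iff_forall y).1 hy V hV
    have hpos : (ν.prod ν) (U ×ˢ V) ≠ 0 := by
      rw [Measure.prod_prod]
      exact mul_ne_zero hUp.ne' hVp.ne'
    apply hpos
    refine measure_mono_null ?_ (ae_iff.1 hχ)
    rintro ⟨u, v⟩ ⟨hu, hv⟩ h
    exact hUV u hu v hv (h χ hχK)
  obtain ⟨z, hz⟩ := Measure.nonempty_support (IsProbabilityMeasure.ne_zero ν)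
  have haez : ∀ᵐ x ∂ν, x = z := by
    filter_upwards [Measure.support_mem_ae (μ := ν)] with x hx
    exact hsupp x hx z hz
  refine ⟨z, ?_, ae_of_ae_map hξmeas.aemeasurable haez⟩
  have h1 : ∀ᵐ p ∂(ν.prod ν), p.1 = z := Measure.quasiMeasurePreserving_fst.ae haez
  have h2 : ∀ᵐ p ∂(ν.prod ν), p.2 = z := Measure.quasiMeasurePreserving_snd.ae haez
  have h3 : ∀ᵐ p ∂(ν.prod ν), p.1 + p.2 = z := by
    refine ae_of_ae_map (p := fun x : K => x = z) hadd_cont.measurable.aemeasurable ?_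
    rw [hidem]
    exact haez
  obtain ⟨p, h1, h2, h3⟩ := (h1.and (h2.and h3)).exists
  rw [h1, h2] at h3
  exact h3
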